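/- (Lemma 1 of the paper.) Let n ≥ 1, f ∈ {0,1}^n, and let Ψ_f : {0,1}^n → ℝ be the Fourier basis function Ψ_f(x) = (−1)^{⟨f,x⟩}. Let 𝒟 be a nonempty finite multiset (list) of points in {0,1}^n, let x* ∈ {0,1}^n, and let i ∈ [n]. Then the SHAP value of feature i for Ψ_f with respect to background dataset 𝒟 and instance x* satisfies φ_i^{Ψ_f} = −(2 f_i / |𝒟|) · Σ_{x ∈ 𝒟} 1[x_i ≠ x*_i] · (−1)^{⟨f,x⟩} · ((|A_x|+1) mod 2)/(|A_x|+1), where for each x ∈ 𝒟, A_x = {j ∈ [n] : x_j ≠ x*_j, j ≠ i, f_j = 1}. -/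

import Mathlib

open Finset

/-- Integer inner product `⟨f,y⟩ = Σ_j f_j y_j` of two points of `{0,1}^n`. -/
def ip {n : ℕ} (f y : Fin n → Fin 2) : ℕ := ∑ j : Fin n, (f j : ℕ) * (y j : ℕ)

/-- Hybrid point: coordinates from `xstar` on `S`, from `x` off `S`. -/
def hybrid {n : ℕ} (xstar x : Fin n → Fin 2) (S : Finset (Fin n)) : Fin n → Fin 2 :=
  fun j => if j ∈ S then xstar j else x j

/-- Shapley kernel weight `|S|!·(n−|S|−1)!/n!`. -/
noncomputable def shapWeight (n : ℕ) (S : Finset (Fin n)) : ℝ :=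
  ((Nat.factorial S.card * Nat.factorial (n - S.card - 1) : ℕ) : ℝ) / (Nat.factorial n : ℝ)

/-- Value function: average prediction over the background dataset `D`
when fixing the coordinates of the explained instance `xstar` on `S`. -/
noncomputable def valueFn {n : ℕ} (h : (Fin n → Fin 2) → ℝ) (D : List (Fin n → Fin 2))
    (xstar : Fin n → Fin 2) (S : Finset (Fin n)) : ℝ :=
  (1 / (D.length : ℝ)) * (D.map (fun x => h (hybrid xstar x S))).sum

/-- SHAP value of feature `i` for predictor `h`, background dataset `D`, instance `xstar`. -/
noncomputable def shapValue {n : ℕ} (h : (Fin n → Fin 2) → ℝ) (D : List (Fin n → Fin 2))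
    (xstar : Fin n → Fin 2) (i : Fin n) : ℝ :=
  ∑ S ∈ (Finset.univ.erase i).powerset,
    shapWeight n S * (valueFn h D xstar (insert i S) - valueFn h D xstar S)

/-- The Euler beta integral at natural parameters. -/
lemma integral_pow_mul_one_sub_pow (s k : ℕ) :
    ∫ t in (0 : ℝ)..1, t ^ s * (1 - t) ^ k
      = ((Nat.factorial s * Nat.factorial k : ℕ) : ℝ) / (Nat.factorial (s + k + 1) : ℝ) := by
  induction k generalizing s with
  | zero =>
    simp only [pow_zero, mul_one, integral_pow, Nat.factorial_zero, add_zero, Nat.factorial_succ]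
    push_cast
    field_simp
    simp
  | succ k ih =>
    have hsplit : ∀ t : ℝ, t ^ s * (1 - t) ^ (k + 1)
        = t ^ s * (1 - t) ^ k - t ^ (s + 1) * (1 - t) ^ k := fun t => by ring
    simp_rw [hsplit]
    rw [intervalIntegral.integral_sub
      (Continuous.intervalIntegrable (by fun_prop) _ _)
      (Continuous.intervalIntegrable (by fun_prop) _ _), ih, ih,
      show s + 1 + k + 1 = (s + k + 1) + 1 by ring, show s + (k + 1) + 1 = (s + k + 1) + 1 by ring,
      Nat.factorial_succ (s + k + 1), Nat.factorial_succ s, Nat.factorial_succ k]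
    push_cast
    field_simp
    ring

lemma integral_one_sub_two_mul_pow (a : ℕ) :
    ∫ t in (0 : ℝ)..1, (1 - 2 * t) ^ a = (((a + 1) % 2 : ℕ) : ℝ) / ((a : ℝ) + 1) := by
  rw [intervalIntegral.integral_comp_sub_mul (fun u : ℝ => u ^ a) two_ne_zero, integral_pow]
  rcases Nat.even_or_odd (a + 1) with h | h
  · norm_num [h.neg_one_pow, Nat.even_iff.mp h]
  · norm_num [h.neg_one_pow, Nat.odd_iff.mp h]
    field_simp

/-- The Shapley weights are the moments of a uniformly random inclusion probability. -/
lemma sum_shapWeight_mul_prod {n : ℕ} (i : Fin n) (c : Fin n → ℝ) :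
    ∑ S ∈ (univ.erase i).powerset, shapWeight n S * ∏ j ∈ S, c j
      = ∫ t in (0 : ℝ)..1, ∏ j ∈ univ.erase i, (t * c j + (1 - t)) := by
  simp_rw [Finset.prod_add]
  rw [intervalIntegral.integral_finsetSum
    fun S _ => Continuous.intervalIntegrable (by fun_prop) _ _]
  refine Finset.sum_congr rfl fun S hS => ?_
  have hS' := Finset.mem_powerset.mp hS
  have hle := Finset.card_le_card hS'
  have hn : 0 < n := i.pos
  have hcard : (univ.erase i).card = n - 1 := by simp
  have hrest : (univ.erase i \ S).card = n - S.card - 1 := by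
    rw [Finset.card_sdiff_of_subset hS', hcard]; omega
  have hterm : ∀ t : ℝ, (∏ j ∈ S, t * c j) * ∏ j ∈ univ.erase i \ S, (1 - t)
      = t ^ S.card * (1 - t) ^ (n - S.card - 1) * ∏ j ∈ S, c j := fun t => by
    rw [Finset.prod_mul_distrib, Finset.prod_const, Finset.prod_const, hrest]; ring
  simp_rw [hterm]
  rw [intervalIntegral.integral_mul_const, integral_pow_mul_one_sub_pow,
    show S.card + (n - S.card - 1) + 1 = n by omega, shapWeight]

lemma neg_one_pow_ip_hybrid {n : ℕ} (f xstar x : Fin n → Fin 2) (S : Finset (Fin n)) :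
    (-1 : ℝ) ^ ip f (hybrid xstar x S)
      = (-1 : ℝ) ^ ip f x * ∏ j ∈ S, (if x j ≠ xstar j ∧ f j = 1 then (-1 : ℝ) else 1) := by
  have hprod : ∏ j ∈ S, (if x j ≠ xstar j ∧ f j = 1 then (-1 : ℝ) else 1)
      = ∏ j, if j ∈ S then (if x j ≠ xstar j ∧ f j = 1 then (-1 : ℝ) else 1) else 1 := by
    simp [Finset.prod_ite_mem]
  rw [hprod, ip, ip, ← Finset.prod_pow_eq_pow_sum, ← Finset.prod_pow_eq_pow_sum,
    ← Finset.prod_mul_distrib]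
  refine Finset.prod_congr rfl fun j _ => ?_
  unfold hybrid
  generalize f j = a, x j = b, xstar j = c
  by_cases hj : j ∈ S
  · fin_cases a <;> fin_cases b <;> fin_cases c <;> simp [hj]
  · simp [hj]

lemma sum_shapWeight_mul_prod_sign {n : ℕ} (f xstar x : Fin n → Fin 2) (i : Fin n) :
    ∑ S ∈ (univ.erase i).powerset,
        shapWeight n S * ∏ j ∈ S, (if x j ≠ xstar j ∧ f j = 1 then (-1 : ℝ) else 1)
      = ((((univ.filter (fun j => x j ≠ xstar j ∧ j ≠ i ∧ f j = 1)).card + 1) % 2 : ℕ) : ℝ) /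
          (((univ.filter (fun j => x j ≠ xstar j ∧ j ≠ i ∧ f j = 1)).card : ℝ) + 1) := by
  rw [sum_shapWeight_mul_prod, ← integral_one_sub_two_mul_pow]
  refine intervalIntegral.integral_congr fun t _ => ?_
  have hA : univ.filter (fun j => x j ≠ xstar j ∧ j ≠ i ∧ f j = 1)
      = (univ.erase i).filter (fun j => x j ≠ xstar j ∧ f j = 1) := by
    ext j
    simp only [mem_filter, mem_univ, mem_erase, true_and, and_true]
    tauto
  have hterm : ∀ j, t * (if x j ≠ xstar j ∧ f j = 1 then (-1 : ℝ) else 1) + (1 - t)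
      = if x j ≠ xstar j ∧ f j = 1 then 1 - 2 * t else 1 := fun j => by
    split_ifs <;> ring
  simp only [hterm]
  rw [hA, ← Finset.prod_filter, Finset.prod_const]

/-- The SHAP value for a dataset is the average of those for its single points. -/
lemma shapValue_eq_sum_map {n : ℕ} (h : (Fin n → Fin 2) → ℝ) (D : List (Fin n → Fin 2))
    (xstar : Fin n → Fin 2) (i : Fin n) :
    shapValue h D xstar i = (1 / (D.length : ℝ)) *
      (D.map fun x => ∑ S ∈ (univ.erase i).powerset, shapWeight n S *
        (h (hybrid xstar x (insert i S)) - h (hybrid xstar x S))).sum := by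
  unfold shapValue valueFn
  generalize 1 / (D.length : ℝ) = r
  simp_rw [← mul_sub, mul_left_comm _ r, ← Finset.mul_sum]
  congr 1
  induction D with
  | nil => simp
  | cons x D ih =>
    simp only [List.map_cons, List.sum_cons]
    rw [← ih, ← Finset.sum_add_distrib]
    exact Finset.sum_congr rfl fun S _ => by ring

/-- Lemma 1 of the paper: closed-form SHAP value of a single
Fourier basis function `Ψ_f(x) = (−1)^{⟨f,x⟩}` w.r.t. background dataset `D`. -/
theorem shap_fourier_basis (n : ℕ) (hn : 1 ≤ n) (f : Fin n → Fin 2)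
    (D : List (Fin n → Fin 2)) (hD : D ≠ []) (xstar : Fin n → Fin 2) (i : Fin n) :
    shapValue (fun x => (-1 : ℝ) ^ ip f x) D xstar i
      = -(2 * ((f i : ℕ) : ℝ) / (D.length : ℝ)) *
        (D.map (fun x =>
          (if x i ≠ xstar i then (1 : ℝ) else 0) * (-1 : ℝ) ^ ip f x *
            (((((Finset.univ.filter
                  (fun j => x j ≠ xstar j ∧ j ≠ i ∧ f j = 1)).card + 1) % 2 : ℕ) : ℝ) /
              (((Finset.univ.filter
                  (fun j => x j ≠ xstar j ∧ j ≠ i ∧ f j = 1)).card : ℝ) + 1)))).sum := by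
  have hpoint : ∀ x : Fin n → Fin 2,
      ∑ S ∈ (univ.erase i).powerset, shapWeight n S *
        ((-1 : ℝ) ^ ip f (hybrid xstar x (insert i S)) - (-1 : ℝ) ^ ip f (hybrid xstar x S))
      = -(2 * ((f i : ℕ) : ℝ)) * ((if x i ≠ xstar i then (1 : ℝ) else 0) * (-1 : ℝ) ^ ip f x *
          (((((univ.filter (fun j => x j ≠ xstar j ∧ j ≠ i ∧ f j = 1)).card + 1) % 2 : ℕ) : ℝ) /
            (((univ.filter (fun j => x j ≠ xstar j ∧ j ≠ i ∧ f j = 1)).card : ℝ) + 1))) := by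
    intro x
    have hsign : (if x i ≠ xstar i ∧ f i = 1 then (-1 : ℝ) else 1) - 1
        = -(2 * ((f i : ℕ) : ℝ)) * (if x i ≠ xstar i then (1 : ℝ) else 0) := by
      generalize f i = a
      by_cases hx : x i = xstar i <;> fin_cases a <;> norm_num [hx]
    rw [← sum_shapWeight_mul_prod_sign, Finset.mul_sum, Finset.mul_sum]
    refine Finset.sum_congr rfl fun S hS => ?_
    have hi : i ∉ S := fun h => Finset.notMem_erase i univ (Finset.mem_powerset.mp hS h)
    rw [neg_one_pow_ip_hybrid, neg_one_pow_ip_hybrid, Finset.prod_insert hi]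
    linear_combination (shapWeight n S * (-1 : ℝ) ^ ip f x *
      ∏ j ∈ S, (if x j ≠ xstar j ∧ f j = 1 then (-1 : ℝ) else 1)) * hsign
  rw [shapValue_eq_sum_map]
  simp only [hpoint]
  rw [List.sum_map_mul_left]
  ring
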